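/- Let k'/k be a finite extension of fields and let k^s be a separable closure of k. Then the ring k' ⊗_k k^s is isomorphic, as a k^s-algebra, to a finite product ∏_{i=1}^n k_i with n ≥ 1, where each k_i is a field that is a finite purely inseparable extension of k^s. -/

import Mathlib

noncomputable section

/-- A decomposition of the commutative `ks`-algebra `M` as a finite nonempty product of
fields, each of which is a finite purely inseparable extension of `ks`. -/
structure PurelyInsepProductDecomp (ks M : Type) [Field ks] [CommRing M]
    [Algebra ks M] where
  n : ℕ
  npos : 0 < n
  K : Fin n → Type
  fieldK : ∀ i, Field (K i)
  algK : ∀ i, letI := fieldK i; Algebra ks (K i)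
  finiteK : ∀ i, letI := fieldK i; letI := algK i; FiniteDimensional ks (K i)
  insepK : ∀ i, letI := fieldK i; letI := algK i; IsPurelyInseparable ks (K i)
  iso : letI : ∀ i, Field (K i) := fieldK
        letI : ∀ i, Algebra ks (K i) := algK
        M ≃ₐ[ks] ((i : Fin n) → K i)

/-- The tensor product of two field extensions is reduced if the second one is separable. -/
theorem isReduced_tensorProduct_of_isSeparable (k K L : Type*) [Field k] [Field K] [Field L]
    [Algebra k K] [Algebra k L] [Algebra.IsSeparable k L] :
    IsReduced (TensorProduct k K L) := by
  refine IsReduced.tensorProduct_of_flat_of_forall_fg fun B hB ↦ ?_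
  have : Algebra.IsAlgebraic k B := .of_injective B.val Subtype.val_injective
  let E : IntermediateField k L := Algebra.IsAlgebraic.toIntermediateField B
  change IsReduced (TensorProduct k K E)
  have : Algebra.FiniteType k E := B.fg_iff_finiteType.mp hB
  have : Algebra.FormallyUnramified k E := .of_isSeparable k E
  exact Algebra.FormallyUnramified.isReduced_of_field K (TensorProduct k K E)

/-- A nontrivial reduced finite algebra over a separably closed field is a nonempty finite product
of finite purely inseparable extensions. -/
theorem nonempty_purelyInsepProductDecomp (F A : Type) [Field F] [IsSepClosed F] [CommRing A]
    [Nontrivial A] [Algebra F A] [Module.Finite F A] [IsReduced A] :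
    Nonempty (PurelyInsepProductDecomp F A) := by
  have : IsArtinianRing A := .of_finite F A
  let e := (Finite.equivFin (MaximalSpectrum A)).symm
  let fieldQuot (i) : Field (A ⧸ (e i).asIdeal) := Ideal.Quotient.field _
  exact ⟨{
    n := Nat.card (MaximalSpectrum A)
    npos := Nat.card_pos
    K := fun i ↦ A ⧸ (e i).asIdeal
    fieldK := fieldQuot
    algK := fun i ↦ inferInstanceAs (Algebra F (A ⧸ (e i).asIdeal))
    finiteK := fun i ↦ inferInstanceAs (Module.Finite F (A ⧸ (e i).asIdeal))
    insepK := fun _ ↦ Algebra.IsAlgebraic.isPurelyInseparable_of_isSepClosed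
    iso := ((IsArtinianRing.equivPi A).restrictScalars F).trans
      (AlgEquiv.piCongrLeft F (fun I : MaximalSpectrum A ↦ A ⧸ I.asIdeal) e).symm }⟩

/-- Let `k'/k` be a finite extension of fields and `ks` a separable
closure of `k`. Then `k' ⊗_k ks`, viewed as a `ks`-algebra via the second factor, is
isomorphic as a `ks`-algebra to a finite product `∏_{i=1}^n k_i` with `n ≥ 1`, where each
`k_i` is a field that is a finite purely inseparable extension of `ks`. -/
theorem statement11 (k k' ks : Type) [Field k] [Field k'] [Field ks]
    [Algebra k k'] [FiniteDimensional k k'] [Algebra k ks] [IsSepClosure k ks] :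
    Nonempty (letI := Algebra.TensorProduct.rightAlgebra (R := k) (A := k') (B := ks)
      PurelyInsepProductDecomp ks (TensorProduct k k' ks)) := by
  have : IsSepClosed ks := IsSepClosure.sep_closed k
  have : Algebra.IsSeparable k ks := IsSepClosure.separable
  let := Algebra.TensorProduct.rightAlgebra (R := k) (A := k') (B := ks)
  have : Module.Finite ks (TensorProduct k k' ks) :=
    .equiv (Algebra.TensorProduct.commRight k ks k').toLinearEquiv
  have := isReduced_tensorProduct_of_isSeparable k k' ks
  exact nonempty_purelyInsepProductDecomp ks (TensorProduct k k' ks)
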